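/- Let A be a finite-dimensional K-algebra and G a finite group acting on A with char K ∤ |G|. Then A is quasi-Koszul if and only if the skew group algebra A ∗ G is quasi-Koszul. -/

import Mathlib

open CategoryTheory

universe u

noncomputable instance (A : Type u) [Ring A] : HasDerivedCategory (ModuleCat.{u} A) :=
  HasDerivedCategory.standard _

instance (A : Type u) [Ring A] : HasExt.{u+1} (ModuleCat.{u} A) :=
  CategoryTheory.hasExt_of_hasDerivedCategory _

/-- The Jacobson radical of a ring, as a left ideal. -/
def jacRad (A : Type u) [Ring A] : Ideal A := Ideal.jacobson ⊥

/-- The semisimple quotient `A/J(A)` as a left `A`-module. -/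
abbrev ssQuot (A : Type u) [Ring A] : ModuleCat.{u} A :=
  ModuleCat.of A (A ⧸ jacRad A)

/-- A ring is semiperfect if `A/J(A)` is semisimple and idempotents lift
modulo the Jacobson radical. -/
def IsSemiperfectRing (A : Type u) [Ring A] : Prop :=
  IsSemisimpleModule A (A ⧸ jacRad A) ∧
    ∀ a : A, a * a - a ∈ jacRad A →
      ∃ e : A, IsIdempotentElem e ∧ e - a ∈ jacRad A

/-- Additive span of Yoneda products. -/
noncomputable def extSpan {C : Type (u+1)} [Category C] [Abelian C] [HasExt.{u+1} C]
    (X Y Z : C) (r l : ℕ) : AddSubgroup (Abelian.Ext X Z (r + l)) :=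
  AddSubgroup.closure { γ | ∃ (α : Abelian.Ext X Y r) (β : Abelian.Ext Y Z l), γ = α.comp β rfl }

/-- A ring `A` is quasi-Koszul if its Yoneda algebra `Ext^*_A(A/J, A/J)` is generated in
degrees 0 and 1: `Ext^i · Ext^1 = Ext^{i+1}` for all `i ≥ 0`. -/
def IsQuasiKoszul (A : Type u) [Ring A] : Prop :=
  ∀ i : ℕ, extSpan (ssQuot A) (ssQuot A) (ssQuot A) i 1 = ⊤

/-- An `A`-module `M` is quasi-Koszul if
`Ext^i_A(M, A/J) · Ext^1_A(A/J, A/J) = Ext^{i+1}_A(M, A/J)` for all `i ≥ 0`. -/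
def IsQuasiKoszulModule (A : Type u) [Ring A] (M : ModuleCat.{u} A) : Prop :=
  ∀ i : ℕ, extSpan M (ssQuot A) (ssQuot A) i 1 = ⊤


/-- `B` is a skew group algebra `A ∗ G` for the action `φ` of `G` on the `K`-algebra `A`:
`B` contains `A` and invertible elements indexed by `G` satisfying the skew commutation
rule `g · a = (g a) · g`, and `B` is free as an `A`-module with basis `G`. -/
structure IsSkewGroupAlgebra (K : Type u) [Field K] (A : Type u) [Ring A] [Algebra K A]
    (G : Type u) [Group G] [Fintype G] (φ : G →* (A ≃ₐ[K] A))
    (B : Type u) [Ring B] [Algebra K B] where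
  ιA : A →ₐ[K] B
  ιG : G →* B
  comm : ∀ (g : G) (a : A), ιG g * ιA a = ιA (φ g a) * ιG g
  free : ∀ b : B, ∃! c : G → A, b = ∑ g : G, ιA (c g) * ιG g

open Abelian in
/-- A retraction of exact endofunctors is natural with respect to extension classes. -/
theorem ext_map_map_comp_mk₀ {C D : Type (u + 1)} [Category.{u} C] [Abelian C] [HasExt.{u + 1} C]
    [EnoughProjectives C] [Category.{u} D] [Abelian D] [HasExt.{u + 1} D]
    (P : C ⥤ D) (Q : D ⥤ C) [P.Additive] [Q.Additive]
    [Limits.PreservesFiniteLimits P] [Limits.PreservesFiniteColimits P]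
    [Limits.PreservesFiniteLimits Q] [Limits.PreservesFiniteColimits Q]
    (τ : P ⋙ Q ⟶ 𝟭 C) {X Y : C} {n : ℕ} (γ : Ext.{u + 1} X Y n) :
    ((γ.mapExactFunctor P).mapExactFunctor Q).comp (Ext.mk₀ (τ.app Y)) (add_zero n) =
      (Ext.mk₀ (τ.app X)).comp γ (zero_add n) := by
  induction n generalizing X Y with
  | zero =>
    obtain ⟨f, rfl⟩ := (Ext.mk₀_bijective X Y).2 γ
    rw [Ext.mapExactFunctor_mk₀, Ext.mapExactFunctor_mk₀, Ext.mk₀_comp_mk₀]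
    erw [Ext.mk₀_comp_mk₀]
    exact congrArg Ext.mk₀ (τ.naturality f)
  | succ n ih =>
    let S := ShortComplex.mk _ _ (Limits.kernel.condition (Projective.π X))
    have hS : S.ShortExact :=
      { exact := ShortComplex.exact_of_f_is_kernel _ (Limits.kernelIsKernel S.g) }
    obtain ⟨δ, rfl⟩ := Ext.contravariant_sequence_exact₃ hS Y γ
      (Ext.eq_zero_of_projective _) (add_comm 1 n)
    have hδ : (hS.extClass.mapExactFunctor P).mapExactFunctor Q =
        ((hS.map_of_exact P).map_of_exact Q).extClass :=
      (congrArg (Ext.mapExactFunctor Q) (Ext.mapExactFunctor_extClass P hS)).trans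
        (Ext.mapExactFunctor_extClass Q (hS.map_of_exact P))
    have hτ := ShortComplex.ShortExact.extClass_naturality
      ((hS.map_of_exact P).map_of_exact Q) hS
      { τ₁ := τ.app S.X₁, τ₂ := τ.app S.X₂, τ₃ := τ.app S.X₃
        comm₁₂ := (τ.naturality S.f).symm, comm₂₃ := (τ.naturality S.g).symm }
    rw [← hδ] at hτ
    rw [Ext.mapExactFunctor_comp, Ext.mapExactFunctor_comp,
      Ext.comp_assoc _ _ _ (add_comm 1 n) (add_zero n) (by lia), ih,
      ← Ext.comp_assoc _ _ _ (add_zero 1) (zero_add n) (by lia),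
      ← Ext.comp_assoc _ _ _ (zero_add 1) (add_comm 1 n) (by lia)]
    exact congrArg (fun t => Ext.comp t δ (add_comm 1 n)) hτ

/-- `M` is a direct summand of a finite direct sum of copies of `S`. -/
def InAddClosure {C : Type (u + 1)} [Category.{u} C] [Preadditive C] (S M : C) : Prop :=
  ∃ (n : ℕ) (i : Fin n → (M ⟶ S)) (p : Fin n → (S ⟶ M)), ∑ k, i k ≫ p k = 𝟙 M

section extSpan

open Abelian

variable {C : Type (u + 1)} [Category.{u} C] [Abelian C] [HasExt.{u + 1} C]

theorem comp_mem_extSpan {X Y Z : C} {r l : ℕ} (α : Ext.{u + 1} X Y r) (β : Ext.{u + 1} Y Z l) :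
    α.comp β rfl ∈ extSpan X Y Z r l :=
  AddSubgroup.subset_closure ⟨α, β, rfl⟩

theorem mk₀_comp_mem_extSpan {W X Y Z : C} {r l : ℕ} (f : W ⟶ X) {γ : Ext.{u + 1} X Z (r + l)}
    (h : γ ∈ extSpan X Y Z r l) :
    (Ext.mk₀ f).comp γ (zero_add _) ∈ extSpan W Y Z r l := by
  induction h using AddSubgroup.closure_induction with
  | mem γ h =>
    obtain ⟨α, β, rfl⟩ := h
    rw [← Ext.comp_assoc (Ext.mk₀ f) α β (zero_add r) rfl (by lia)]
    exact comp_mem_extSpan _ _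
  | zero => rw [Ext.comp_zero]; exact zero_mem _
  | add x y _ _ hx hy => rw [Ext.comp_add]; exact add_mem hx hy
  | neg x _ hx => rw [Ext.comp_neg]; exact neg_mem hx

theorem comp_mk₀_mem_extSpan {X Y Z W : C} {r l : ℕ} (f : Z ⟶ W) {γ : Ext.{u + 1} X Z (r + l)}
    (h : γ ∈ extSpan X Y Z r l) :
    γ.comp (Ext.mk₀ f) (add_zero _) ∈ extSpan X Y W r l := by
  induction h using AddSubgroup.closure_induction with
  | mem γ h =>
    obtain ⟨α, β, rfl⟩ := h
    rw [Ext.comp_assoc α β (Ext.mk₀ f) rfl (add_zero l) (by lia)]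
    exact comp_mem_extSpan _ _
  | zero => rw [Ext.zero_comp]; exact zero_mem _
  | add x y _ _ hx hy => rw [Ext.add_comp]; exact add_mem hx hy
  | neg x _ hx => rw [Ext.neg_comp]; exact neg_mem hx

theorem extSpan_eq_top_of_inAddClosure {S X Z : C} {r l : ℕ} (hX : InAddClosure S X)
    (hZ : InAddClosure S Z) (h : extSpan S S S r l = ⊤) : extSpan X S Z r l = ⊤ := by
  obtain ⟨n, i, p, hip⟩ := hX
  obtain ⟨m, j, q, hjq⟩ := hZ
  refine eq_top_iff.mpr fun γ _ => ?_
  rw [← Ext.mk₀_id_comp γ, ← hip, Ext.mk₀_sum, Ext.sum_comp]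
  refine sum_mem fun k _ => ?_
  rw [← Ext.mk₀_comp_mk₀, Ext.comp_assoc _ _ _ (zero_add 0) (zero_add _) (by lia)]
  refine mk₀_comp_mem_extSpan _ ?_
  rw [← Ext.comp_mk₀_id (Ext.comp _ _ _), ← hjq, Ext.mk₀_sum, Ext.comp_sum]
  refine sum_mem fun k' _ => ?_
  rw [← Ext.mk₀_comp_mk₀, ← Ext.comp_assoc _ _ _ (add_zero _) (add_zero _) (by lia)]
  exact comp_mk₀_mem_extSpan _ (h ▸ AddSubgroup.mem_top _)

theorem extSpan_le_of_inAddClosure {S X Y Z : C} {r l : ℕ} (hY : InAddClosure S Y) :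
    extSpan X Y Z r l ≤ extSpan X S Z r l := by
  obtain ⟨n, i, p, hip⟩ := hY
  refine (AddSubgroup.closure_le _).mpr ?_
  rintro _ ⟨α, β, rfl⟩
  rw [← Ext.comp_mk₀_id α, ← hip, Ext.mk₀_sum, Ext.comp_sum, Ext.sum_comp]
  refine sum_mem fun k _ => ?_
  rw [← Ext.mk₀_comp_mk₀, ← Ext.comp_assoc _ _ _ (add_zero _) (add_zero _) (by lia),
    Ext.comp_assoc _ (Ext.mk₀ (p k)) β (add_zero _) (zero_add _) (by lia)]
  exact comp_mem_extSpan _ _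

theorem mapExactFunctor_mem_extSpan {D : Type (u + 1)} [Category.{u} D] [Abelian D]
    [HasExt.{u + 1} D] (P : C ⥤ D) [P.Additive] [Limits.PreservesFiniteLimits P]
    [Limits.PreservesFiniteColimits P] {X Y Z : C} {r l : ℕ} {γ : Ext.{u + 1} X Z (r + l)}
    (h : γ ∈ extSpan X Y Z r l) :
    γ.mapExactFunctor P ∈ extSpan (P.obj X) (P.obj Y) (P.obj Z) r l := by
  suffices extSpan X Y Z r l ≤ (extSpan (P.obj X) (P.obj Y) (P.obj Z) r l).comap
      (P.mapExtAddHom X Z (r + l)) from this h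
  refine (AddSubgroup.closure_le _).mpr ?_
  rintro _ ⟨α, β, rfl⟩
  simp only [AddSubgroup.coe_comap, Set.mem_preimage, Functor.mapExtAddHom_apply,
    Ext.mapExactFunctor_comp]
  exact comp_mem_extSpan _ _

/-- Generation of extension groups by Yoneda products descends along an exact functor `P`
such that the identity is a retract of `P ⋙ Q` for some exact functor `Q`. -/
theorem extSpan_eq_top_of_retract {D : Type (u + 1)} [EnoughProjectives C]
    [Category.{u} D] [Abelian D] [HasExt.{u + 1} D]
    (P : C ⥤ D) (Q : D ⥤ C) [P.Additive] [Q.Additive]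
    [Limits.PreservesFiniteLimits P] [Limits.PreservesFiniteColimits P]
    [Limits.PreservesFiniteLimits Q] [Limits.PreservesFiniteColimits Q]
    (τ : P ⋙ Q ⟶ 𝟭 C) {S : C} {T : D} (σ : S ⟶ Q.obj (P.obj S)) (hσ : σ ≫ τ.app S = 𝟙 S)
    (hS : InAddClosure T (P.obj S)) (hT : InAddClosure S (Q.obj T)) {r l : ℕ}
    (h : extSpan T T T r l = ⊤) : extSpan S S S r l = ⊤ := by
  refine eq_top_iff.mpr fun γ _ => ?_
  have h₁ : γ.mapExactFunctor P ∈ extSpan (P.obj S) T (P.obj S) r l :=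
    extSpan_eq_top_of_inAddClosure hS hS h ▸ AddSubgroup.mem_top _
  have h₂ := extSpan_le_of_inAddClosure hT (mapExactFunctor_mem_extSpan Q h₁)
  have h₃ := mk₀_comp_mem_extSpan σ (comp_mk₀_mem_extSpan (τ.app S) h₂)
  rw [ext_map_map_comp_mk₀ P Q τ γ, Ext.mk₀_comp_mk₀_assoc] at h₃
  erw [hσ] at h₃
  rwa [Ext.mk₀_id_comp] at h₃

end extSpan


section ssQuot

variable (A : Type u) [Ring A]

instance isTwoSided_jacRad : (jacRad A).IsTwoSided :=
  inferInstanceAs (Ideal.jacobson (⊥ : Ideal A)).IsTwoSided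

theorem isSemisimpleModule_quotient_jacRad [IsArtinianRing A] :
    IsSemisimpleModule A (A ⧸ jacRad A) := by
  rw [IsArtinian.isSemisimpleModule_iff_jacobson, jacRad, Ideal.jacobson_bot]
  exact Module.jacobson_quotient_jacobson A A

variable {A}

theorem smul_quotient_jacRad_eq_zero {x : A} (hx : x ∈ jacRad A) (m : A ⧸ jacRad A) :
    x • m = 0 := by
  obtain ⟨b, rfl⟩ := Submodule.Quotient.mk_surjective _ m
  rw [← Submodule.Quotient.mk_smul, Submodule.Quotient.mk_eq_zero]
  exact Ideal.mul_mem_right b _ hx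

theorem smul_eq_zero_of_mem_jacRad {M : Type*} [AddCommGroup M] [Module A M]
    [IsSemisimpleModule A M] {x : A} (hx : x ∈ jacRad A) (m : M) : x • m = 0 := by
  rw [jacRad, Ideal.jacobson_bot] at hx
  exact Module.mem_annihilator.mp (IsSemisimpleModule.jacobson_le_annihilator A M hx) m

/-- The linear map `(A/J)ⁿ → M` attached to a family of elements of a module killed by `J`. -/
noncomputable def ssQuotCombination {M : Type*} [AddCommGroup M] [Module A M]
    (hM : ∀ x ∈ jacRad A, ∀ m : M, x • m = 0) {ι : Type*} (v : ι → M) :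
    (ι →₀ (A ⧸ jacRad A)) →ₗ[A] M :=
  Finsupp.lsum ℕ fun k =>
    (jacRad A).liftQ (LinearMap.toSpanSingleton A M (v k)) fun x hx => hM x hx (v k)

theorem ssQuotCombination_single_mk {M : Type*} [AddCommGroup M] [Module A M]
    (hM : ∀ x ∈ jacRad A, ∀ m : M, x • m = 0) {ι : Type*} (v : ι → M) (k : ι) (a : A) :
    ssQuotCombination hM v (Finsupp.single k (Submodule.Quotient.mk a)) = a • v k := by
  rw [ssQuotCombination, Finsupp.lsum_single]
  rfl

theorem ssQuotCombination_surjective {M : Type*} [AddCommGroup M] [Module A M]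
    (hM : ∀ x ∈ jacRad A, ∀ m : M, x • m = 0) {ι : Type*} (v : ι → M)
    (hv : Submodule.span A (Set.range v) = ⊤) :
    Function.Surjective (ssQuotCombination hM v) := by
  rw [← LinearMap.range_eq_top, eq_top_iff, ← hv, Submodule.span_le]
  rintro _ ⟨k, rfl⟩
  exact ⟨Finsupp.single k (Submodule.Quotient.mk 1), by
    rw [ssQuotCombination_single_mk, one_smul]⟩

theorem isSemisimpleModule_of_jacRad_smul_eq_zero [IsArtinianRing A] {M : Type*} [AddCommGroup M]
    [Module A M] (hM : ∀ x ∈ jacRad A, ∀ m : M, x • m = 0) : IsSemisimpleModule A M := by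
  have := isSemisimpleModule_quotient_jacRad A
  exact IsSemisimpleModule.of_surjective _
    (ssQuotCombination_surjective hM (id : M → M) (by simp))

theorem inAddClosure_ssQuot [IsArtinianRing A] (M : ModuleCat.{u} A) [Module.Finite A M]
    (hM : ∀ x ∈ jacRad A, ∀ m : M, x • m = 0) : InAddClosure (ssQuot A) M := by
  have := isSemisimpleModule_quotient_jacRad A
  obtain ⟨n, v, hv⟩ := Module.Finite.exists_fin (R := A) (M := M)
  obtain ⟨s, hs⟩ := IsSemisimpleModule.lifting_property
    (ssQuotCombination hM v) (ssQuotCombination_surjective hM v hv) LinearMap.id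
  refine ⟨n, fun k => ModuleCat.ofHom (Finsupp.lapply k ∘ₗ s),
    fun k => ModuleCat.ofHom (ssQuotCombination hM v ∘ₗ Finsupp.lsingle k), ?_⟩
  ext m
  have h : ssQuotCombination hM v (s m) = m := LinearMap.congr_fun hs m
  rw [← Finsupp.univ_sum_single (s m), map_sum] at h
  simpa [ModuleCat.hom_sum, LinearMap.sum_apply] using h

end ssQuot

namespace IsSkewGroupAlgebra

variable {K : Type u} [Field K] {A : Type u} [Ring A] [Algebra K A]
    {G : Type u} [Group G] [Fintype G] {φ : G →* (A ≃ₐ[K] A)}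
    {B : Type u} [Ring B] [Algebra K B] (H : IsSkewGroupAlgebra K A G φ B)

include H in
theorem finite [Module.Finite K A] : Module.Finite K B := by
  refine Module.Finite.of_surjective
    (∑ g : G, LinearMap.mulRight K (H.ιG g) ∘ₗ H.ιA.toLinearMap ∘ₗ LinearMap.proj g :
      (G → A) →ₗ[K] B) fun b => ?_
  obtain ⟨c, hc, -⟩ := H.free b
  exact ⟨c, by simp [hc]⟩

/-- The coefficients of an element of a skew group algebra. -/
noncomputable def coeff (b : B) : G → A := (H.free b).choose

theorem sum_coeff (b : B) : ∑ g, H.ιA (H.coeff b g) * H.ιG g = b :=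
  (H.free b).choose_spec.1.symm

theorem coeff_eq {b : B} {c : G → A} (h : ∑ g, H.ιA (c g) * H.ιG g = b) : H.coeff b = c :=
  ((H.free b).choose_spec.2 c h.symm).symm

theorem coeff_add (b b' : B) : H.coeff (b + b') = H.coeff b + H.coeff b' :=
  H.coeff_eq (by simp [add_mul, Finset.sum_add_distrib, sum_coeff])

theorem coeff_ιA_mul (a : A) (b : B) (g : G) : H.coeff (H.ιA a * b) g = a * H.coeff b g :=
  congrFun (H.coeff_eq (c := fun g => a * H.coeff b g)
    (by simp [mul_assoc, ← Finset.mul_sum, sum_coeff])) g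

theorem coeff_mul_ιA (a : A) (b : B) (g : G) : H.coeff (b * H.ιA a) g = H.coeff b g * φ g a :=
  congrFun (H.coeff_eq (c := fun g => H.coeff b g * φ g a) (by
    conv_rhs => rw [← H.sum_coeff b, Finset.sum_mul]
    simp [mul_assoc, H.comm])) g

open Classical in
theorem coeff_ιG (g : G) : H.coeff (H.ιG g) = Pi.single g 1 :=
  H.coeff_eq (by
    rw [Finset.sum_eq_single g]
    · simp
    · intro h _ hg; simp [Pi.single_eq_of_ne hg]
    · simp)

theorem smul_eq_sum {M : Type*} [AddCommGroup M] [Module B M] (b : B) (m : M) :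
    b • m = ∑ g, H.ιA (H.coeff b g) • H.ιG g • m := by
  conv_lhs => rw [← H.sum_coeff b, Finset.sum_smul]
  simp [mul_smul]

/-- `B` as a left `A`-module. -/
noncomputable abbrev restrict (M : Type u) [AddCommGroup M] [Module B M] : ModuleCat.{u} A :=
  (ModuleCat.restrictScalars (H.ιA : A →+* B)).obj (ModuleCat.of B M)

/-- The elements of `G` form a basis of `B` as a left `A`-module. -/
noncomputable def basis : Module.Basis G A (H.restrict B) :=
  .ofEquivFun
    { toFun := H.coeff
      invFun c := ∑ g, H.ιA (c g) * H.ιG g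
      map_add' := H.coeff_add
      map_smul' a b := funext (H.coeff_ιA_mul a b)
      left_inv := H.sum_coeff
      right_inv _ := H.coeff_eq rfl }

instance finite_restrict (M : Type u) [AddCommGroup M] [Module B M] [Module.Finite B M] :
    Module.Finite A (H.restrict M) := by
  obtain ⟨n, v, hv⟩ := Module.Finite.exists_fin (R := B) (M := M)
  let w : Fin n × G → H.restrict M := fun k => (H.ιG k.2 • v k.1 : M)
  refine Module.finite_def.mpr
    (Submodule.fg_def.mpr ⟨Set.range w, Set.finite_range w, eq_top_iff.mpr fun m _ => ?_⟩)
  let m' : M := m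
  obtain ⟨c, hc⟩ := (Submodule.mem_span_range_iff_exists_fun B).mp
    (hv ▸ Submodule.mem_top : m' ∈ Submodule.span B (Set.range v))
  have hm : m' = ∑ k, ∑ g, H.ιA (H.coeff (c k) g) • H.ιG g • v k := by
    simp_rw [← H.smul_eq_sum, hc]
  exact Set.mem_of_eq_of_mem hm (sum_mem fun k _ => sum_mem fun g _ =>
    Submodule.smul_mem _ (H.coeff (c k) g) (Submodule.subset_span (Set.mem_range_self (k, g))))

/-- Averaging over `G` turns an `A`-linear map into a `B`-linear map. -/
noncomputable def average {M N : Type*} [AddCommGroup M] [Module B M] [AddCommGroup N] [Module B N]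
    (f : M →+ N) (hf : ∀ a m, f (H.ιA a • m) = H.ιA a • f m) : M →ₗ[B] N where
  toFun m := algebraMap K B (Fintype.card G : K)⁻¹ • ∑ g, H.ιG g⁻¹ • f (H.ιG g • m)
  map_add' x y := by simp [Finset.sum_add_distrib]
  map_smul' b m := by
    have hA (a : A) (m : M) : ∑ g, H.ιG g⁻¹ • f (H.ιG g • H.ιA a • m) =
        H.ιA a • ∑ g, H.ιG g⁻¹ • f (H.ιG g • m) := by
      rw [Finset.smul_sum]
      refine Finset.sum_congr rfl fun g _ => ?_
      rw [← mul_smul, H.comm, mul_smul, hf, ← mul_smul, H.comm, mul_smul, ← AlgEquiv.mul_apply,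
        ← map_mul, inv_mul_cancel, map_one, AlgEquiv.one_apply]
    have hG (h : G) (m : M) : ∑ g, H.ιG g⁻¹ • f (H.ιG g • H.ιG h • m) =
        H.ιG h • ∑ g, H.ιG g⁻¹ • f (H.ιG g • m) := by
      rw [Finset.smul_sum]
      refine Fintype.sum_equiv (Equiv.mulRight h) _ _ fun g => ?_
      simp [← mul_smul, ← map_mul]
    rw [RingHom.id_apply, ← mul_smul, ← Algebra.commutes, mul_smul]
    congr 1
    conv_lhs => enter [2, g]; rw [H.smul_eq_sum b m, Finset.smul_sum, map_sum, Finset.smul_sum]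
    rw [Finset.sum_comm, H.smul_eq_sum b]
    exact Finset.sum_congr rfl fun h _ => by rw [hA, hG]

theorem average_apply {M N : Type*} [AddCommGroup M] [Module B M] [AddCommGroup N] [Module B N]
    (f : M →+ N) (hf : ∀ a m, f (H.ιA a • m) = H.ιA a • f m) (m : M) :
    H.average f hf m =
      algebraMap K B (Fintype.card G : K)⁻¹ • ∑ g, H.ιG g⁻¹ • f (H.ιG g • m) := rfl

theorem average_eq_of_forall {M N : Type*} [AddCommGroup M] [Module B M] [AddCommGroup N]
    [Module B N] (hchar : (Fintype.card G : K) ≠ 0)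
    (f : M →+ N) (hf : ∀ a m, f (H.ιA a • m) = H.ιA a • f m) {m : M} {n : N}
    (h : ∀ g, f (H.ιG g • m) = H.ιG g • n) : H.average f hf m = n := by
  simp only [average_apply, h, ← mul_smul, ← map_mul, inv_mul_cancel, map_one, one_smul,
    Finset.sum_const, Finset.card_univ]
  rw [← Nat.cast_smul_eq_nsmul B, ← map_natCast (algebraMap K B), ← mul_smul, ← map_mul,
    inv_mul_cancel₀ hchar, map_one, one_smul]

omit [Fintype G] in
theorem φ_mem_jacRad (g : G) {x : A} (hx : x ∈ jacRad A) : φ g x ∈ jacRad A := by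
  rw [jacRad, Ideal.mem_jacobson_iff] at hx ⊢
  intro y
  obtain ⟨z, hz⟩ := hx ((φ g).symm y)
  exact ⟨φ g z, by simpa using congrArg (φ g) hz⟩

theorem ιA_mem_jacRad {x : A} (hx : x ∈ jacRad A) : H.ιA x ∈ jacRad B := by
  rw [jacRad, Ideal.jacobson, Ideal.mem_sInf]
  rintro m ⟨-, hm⟩
  have : IsSimpleModule B (B ⧸ m) := isSimpleModule_iff_isCoatom.mpr hm.out
  let N : Submodule A (H.restrict (B ⧸ m)) := jacRad A • ⊤
  have hNA (a : A) (y : B ⧸ m) (hy : y ∈ N) : H.ιA a • y ∈ N := N.smul_mem a hy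
  have hNG (g : G) (y : B ⧸ m) (hy : y ∈ N) : H.ιG g • y ∈ N := by
    induction hy using Submodule.smul_induction_on' with
    | smul a ha z _ =>
      have h : H.ιG g • H.ιA a • (show B ⧸ m from z) = H.ιA (φ g a) • H.ιG g • z := by
        rw [← mul_smul, H.comm, mul_smul]
      exact h ▸ Submodule.smul_mem_smul (N := (⊤ : Submodule A (H.restrict (B ⧸ m))))
        (φ_mem_jacRad g ha) trivial
    | add x _ y _ hx hy => exact (smul_add (H.ιG g) (x : B ⧸ m) y) ▸ N.add_mem hx hy
  let N' : Submodule B (B ⧸ m) :=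
    { carrier := {y | y ∈ N}
      add_mem' := N.add_mem
      zero_mem' := N.zero_mem
      smul_mem' b y hy := by
        rw [H.smul_eq_sum b y]
        exact N.sum_mem fun g _ => hNA _ _ (hNG _ _ hy) }
  rcases eq_bot_or_eq_top N' with h | h
  · have hx1 : H.ιA x • (Submodule.Quotient.mk 1 : B ⧸ m) ∈ N' :=
      Submodule.smul_mem_smul (N := (⊤ : Submodule A (H.restrict (B ⧸ m)))) hx trivial
    rw [h, Submodule.mem_bot, ← Submodule.Quotient.mk_smul, Submodule.Quotient.mk_eq_zero] at hx1
    simpa using hx1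
  · have hN : (⊤ : Submodule A (H.restrict (B ⧸ m))) ≤ Ring.jacobson A • ⊤ := by
      rw [← Ideal.jacobson_bot]
      intro y _
      let y' : B ⧸ m := y
      have hy : y' ∈ N' := h ▸ Submodule.mem_top
      exact hy
    have hbot := Submodule.FG.eq_bot_of_le_jacobson_smul Module.Finite.fg_top hN
    have hy (y : H.restrict (B ⧸ m)) : y = 0 :=
      (Submodule.mem_bot A).mp (hbot ▸ Submodule.mem_top)
    exact (Submodule.Quotient.mk_eq_zero m).mp (hy (Submodule.Quotient.mk (p := m) (H.ιA x)))

/-- Maschke's theorem for skew group algebras. -/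
theorem isSemisimpleModule (hchar : (Fintype.card G : K) ≠ 0) (M : Type u) [AddCommGroup M]
    [Module B M] [IsSemisimpleModule A (H.restrict M)] : IsSemisimpleModule B M where
  exists_isCompl N := by
    let N' : Submodule A (H.restrict M) :=
      { carrier := {y | y ∈ N}
        add_mem' := N.add_mem
        zero_mem' := N.zero_mem
        smul_mem' a y hy := N.smul_mem (H.ιA a) hy }
    obtain ⟨P, hP⟩ := exists_isCompl N'
    let π := Submodule.projectionOnto N' P hP
    let f : M →+ N := π.toAddMonoidHom
    refine ⟨_, LinearMap.isCompl_of_proj (f := H.average f fun a m => π.map_smul a m) fun n => ?_⟩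
    refine H.average_eq_of_forall hchar f _ fun g => ?_
    let y : N' := ⟨(H.ιG g • (n : M) : M), N.smul_mem (H.ιG g) n.2⟩
    exact Submodule.projectionOnto_apply_left hP y

/-- The functor `Hom_A(B, -)`. -/
noncomputable abbrev coextend : ModuleCat.{u} A ⥤ ModuleCat.{u} B :=
  ModuleCat.coextendScalars (H.ιA : A →+* B)

/-- The restriction functor along `A → B`. -/
noncomputable abbrev restriction : ModuleCat.{u} B ⥤ ModuleCat.{u} A :=
  ModuleCat.restrictScalars (H.ιA : A →+* B)

/-- The restriction-coextension adjunction. -/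
noncomputable abbrev adj : H.restriction ⊣ H.coextend :=
  ModuleCat.restrictCoextendScalarsAdj (H.ιA : A →+* B)

theorem preservesEpimorphisms_coextend : H.coextend.PreservesEpimorphisms where
  preserves {M N} g hg := by
    rw [ModuleCat.epi_iff_surjective] at hg ⊢
    intro f
    have := Module.Projective.of_basis H.basis
    obtain ⟨h, hh⟩ := Module.projective_lifting_property g.hom
      (ModuleCat.CoextendScalars.equiv (H.ιA : A →+* B) N f) hg
    exact ⟨(ModuleCat.CoextendScalars.equiv (H.ιA : A →+* B) M).symm h,
      ModuleCat.CoextendScalars.ext hh⟩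

instance : H.coextend.Additive := H.adj.right_adjoint_additive

instance : Limits.PreservesFiniteLimits H.coextend :=
  have := H.adj.rightAdjoint_preservesLimits
  inferInstance

instance : Limits.PreservesFiniteColimits H.coextend := by
  have := H.preservesEpimorphisms_coextend
  rw [Functor.preservesFiniteColimits_iff_forall_exact_map_and_epi]
  intro S hS
  have := hS.epi_g
  exact ⟨((Functor.preservesFiniteLimits_iff_forall_exact_map_and_mono _).mp inferInstance S hS).1,
    inferInstance⟩

instance : Limits.PreservesFiniteColimits H.restriction :=
  have := H.adj.leftAdjoint_preservesColimits
  inferInstance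

instance : Limits.PreservesFiniteLimits H.restriction := by
  rw [Functor.preservesFiniteLimits_iff_forall_exact_map_and_mono]
  intro S hS
  have := hS.mono_f
  refine ⟨?_, inferInstance⟩
  have h := hS.exact
  rw [ShortComplex.ShortExact.moduleCat_exact_iff_function_exact] at h ⊢
  exact h

/-- The map `M → Hom_A(B, M)` sending `m` to `b ↦ b₁ m`, where `b₁` is the coefficient of `b`
at the identity of `G`. -/
noncomputable def counitSection (M : ModuleCat.{u} A) :
    M ⟶ H.restriction.obj (H.coextend.obj M) :=
  ModuleCat.ofHom (Y := H.restriction.obj (H.coextend.obj M))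
    { toFun m := (ModuleCat.CoextendScalars.equiv (H.ιA : A →+* B) M).symm
        { toFun b := H.coeff b 1 • m
          map_add' b b' := (congrArg (· • m) (congrFun (H.coeff_add b b') 1)).trans
            (add_smul _ _ _)
          map_smul' a b := (congrArg (· • m) (H.coeff_ιA_mul a b 1)).trans (mul_smul _ _ _) }
      map_add' m m' := ModuleCat.CoextendScalars.ext (LinearMap.ext fun b => smul_add _ _ _)
      map_smul' a m := ModuleCat.CoextendScalars.ext (LinearMap.ext fun b => by
        have h := H.coeff_mul_ιA a b 1
        rw [map_one, AlgEquiv.one_apply] at h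
        exact (mul_smul _ _ _).symm.trans (congrArg (· • m) h.symm)) }

theorem counitSection_comp_counit (M : ModuleCat.{u} A) :
    H.counitSection M ≫ H.adj.counit.app M = 𝟙 M := by
  ext m
  have h : H.coeff (1 : B) 1 = 1 := by
    classical rw [← map_one H.ιG, H.coeff_ιG, Pi.single_eq_same]
  exact (congrArg (· • m) h).trans (one_smul _ _)

/-- Evaluation at an element of `B`. -/
noncomputable def coextendEval (M : ModuleCat.{u} A) (b : B) : H.coextend.obj M →+ M where
  toFun f := f b
  map_zero' := rfl
  map_add' _ _ := rfl

/-- Evaluation at `1` on the coextension of a `B`-module. -/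
noncomputable def evalOne (M : ModuleCat.{u} B) : H.coextend.obj (H.restriction.obj M) →+ M :=
  H.coextendEval (H.restriction.obj M) 1

theorem evalOne_smul (M : ModuleCat.{u} B) (a : A) (f : H.coextend.obj (H.restriction.obj M)) :
    H.evalOne M (H.ιA a • f) = H.ιA a • H.evalOne M f :=
  (H.adj.counit.app (H.restriction.obj M)).hom.map_smul a f

/-- The averaged evaluation map `Hom_A(B, M) → M` for a `B`-module `M`. -/
noncomputable def unitRetraction : H.restriction ⋙ H.coextend ⟶ 𝟭 (ModuleCat.{u} B) where
  app M := ModuleCat.ofHom (X := H.coextend.obj (H.restriction.obj M)) (Y := M)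
    (H.average (H.evalOne M) (H.evalOne_smul M))
  naturality M N f := by
    ext x
    refine Eq.trans ?_ (map_smul f.hom _ _).symm
    rw [map_sum]
    refine congrArg _ (Finset.sum_congr rfl fun g _ => ?_)
    rw [map_smul f.hom]
    let F := (H.coextend.map (H.restriction.map f)).hom
    have h : H.evalOne N (H.ιG g • F x) = H.evalOne N (F (H.ιG g • x)) :=
      congrArg (H.evalOne N) (map_smul F _ _).symm
    exact congrArg (H.ιG g⁻¹ • ·) h

theorem unit_comp_unitRetraction (hchar : (Fintype.card G : K) ≠ 0) (M : ModuleCat.{u} B) :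
    H.adj.unit.app M ≫ H.unitRetraction.app M = 𝟙 M := by
  ext m
  exact H.average_eq_of_forall hchar (H.evalOne M) (H.evalOne_smul M) fun g =>
    congrArg (· • (m : M)) (one_mul (H.ιG g))

theorem inAddClosure_restriction_ssQuot [IsArtinianRing A] :
    InAddClosure (ssQuot A) (H.restriction.obj (ssQuot B)) := by
  have : Module.Finite A (H.restriction.obj (ssQuot B)) := H.finite_restrict (B ⧸ jacRad B)
  exact inAddClosure_ssQuot _ fun x hx m => smul_quotient_jacRad_eq_zero (H.ιA_mem_jacRad hx) m

theorem coextend_ext {M : ModuleCat.{u} A} {f f' : H.coextend.obj M}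
    (h : ∀ g, f (H.ιG g) = f' (H.ιG g)) : f = f' := by
  classical
  refine ModuleCat.CoextendScalars.ext (H.basis.ext fun g => ?_)
  have hg : H.basis g = H.ιG g :=
    H.basis.equivFun.injective ((funext fun h => by
      rw [Module.Basis.equivFun_self, Pi.single_apply, if_congr eq_comm rfl rfl]).trans
      (H.coeff_ιG g).symm)
  rw [hg]
  exact h g

/-- `counitSection` as a map into the `B`-module `Hom_A(B, M)`. -/
noncomputable def delta {M : ModuleCat.{u} A} (m : M) : H.coextend.obj M :=
  (H.counitSection M).hom m

theorem sum_smul_delta {M : ModuleCat.{u} A} (f : H.coextend.obj M) :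
    ∑ g, H.ιG g⁻¹ • H.delta (f (H.ιG g)) = f := by
  classical
  refine H.coextend_ext fun h => ?_
  have key (g : G) : H.coextendEval M (H.ιG h) (H.ιG g⁻¹ • H.delta (f (H.ιG g))) =
      (Pi.single (h * g⁻¹) 1 : G → A) 1 • f (H.ιG g) := by
    rw [← H.coeff_ιG, map_mul]
    rfl
  refine (map_sum (H.coextendEval M (H.ιG h)) _ _).trans ?_
  rw [Finset.sum_congr rfl fun g _ => key g, Finset.sum_eq_single h]
  · simp
  · intro g _ hg
    rw [Pi.single_eq_of_ne (fun h1 => hg (mul_inv_eq_one.mp h1.symm).symm), zero_smul]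
  · simp

theorem inAddClosure_coextend_ssQuot [IsArtinianRing A] [IsArtinianRing B]
    (hchar : (Fintype.card G : K) ≠ 0) :
    InAddClosure (ssQuot B) (H.coextend.obj (ssQuot A)) := by
  have : IsSemisimpleModule A (H.restrict (H.coextend.obj (ssQuot A))) := by
    refine isSemisimpleModule_of_jacRad_smul_eq_zero fun x hx f => ?_
    refine H.coextend_ext fun g => ?_
    have h := (ModuleCat.CoextendScalars.equiv (H.ιA : A →+* B) (ssQuot A) f).map_smul
      (φ g x) (H.ιG g)
    exact (congrArg (ModuleCat.CoextendScalars.equiv (H.ιA : A →+* B) (ssQuot A) f)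
      (H.comm g x)).trans (h.trans (smul_quotient_jacRad_eq_zero (φ_mem_jacRad g hx) _))
  have := H.isSemisimpleModule hchar (H.coextend.obj (ssQuot A))
  have : Module.Finite B (H.coextend.obj (ssQuot A)) := by
    let e : ssQuot A := (Submodule.Quotient.mk 1 : A ⧸ jacRad A)
    refine ⟨⟨{H.delta e}, eq_top_iff.mpr fun f _ => ?_⟩⟩
    rw [Finset.coe_singleton, ← H.sum_smul_delta f]
    refine sum_mem fun g _ => Submodule.smul_mem _ _ ?_
    obtain ⟨a, ha⟩ := Submodule.Quotient.mk_surjective _ (f (H.ιG g))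
    have hae : a • e = f (H.ιG g) :=
      ((Submodule.Quotient.mk_smul (jacRad A) a 1).symm.trans
        (congrArg Submodule.Quotient.mk (mul_one a))).trans ha
    have h : H.delta (a • e) = H.ιA a • H.delta e := (H.counitSection (ssQuot A)).hom.map_smul a e
    rw [← hae, h]
    exact Submodule.smul_mem _ _ (Submodule.mem_span_singleton_self _)
  exact inAddClosure_ssQuot _ fun x hx f => smul_eq_zero_of_mem_jacRad hx f

end IsSkewGroupAlgebra

/- STATEMENT 12: For a finite-dimensional K-algebra A with an action of a finite group G
such that char K ∤ |G|, A is quasi-Koszul iff the skew group algebra A ∗ G is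
quasi-Koszul. -/

theorem stmt12 (K : Type u) [Field K] (A : Type u) [Ring A] [Algebra K A]
    [FiniteDimensional K A]
    (G : Type u) [Group G] [Fintype G] (φ : G →* (A ≃ₐ[K] A))
    (B : Type u) [Ring B] [Algebra K B]
    (H : IsSkewGroupAlgebra K A G φ B)
    (hchar : (Fintype.card G : K) ≠ 0) :
    IsQuasiKoszul A ↔ IsQuasiKoszul B := by
  have := H.finite
  have : IsArtinianRing A := IsArtinianRing.of_finite K A
  have : IsArtinianRing B := IsArtinianRing.of_finite K B
  exact
    ⟨fun h i => extSpan_eq_top_of_retract H.restriction H.coextend H.unitRetraction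
      (H.adj.unit.app _) (H.unit_comp_unitRetraction hchar _)
      H.inAddClosure_restriction_ssQuot (H.inAddClosure_coextend_ssQuot hchar) (h i),
    fun h i => extSpan_eq_top_of_retract H.coextend H.restriction H.adj.counit
      (H.counitSection _) (H.counitSection_comp_counit _)
      (H.inAddClosure_coextend_ssQuot hchar) H.inAddClosure_restriction_ssQuot (h i)⟩
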